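/- Let U be a finite-dimensional real vector space of dimension at least 6 and let ζ be a nondegenerate 2-form on U. If β is a 2-form on U with ζ ∧ β = 0 (as a 4-form), then β = 0; i.e., wedging with ζ is injective from 2-forms to 4-forms. -/

import Mathlib

open Module

/-- The wedge product of two 2-forms (alternating bilinear forms) on a real vector
space `U`, evaluated on four vectors, given by the usual alternating sum over all
permutations (a positive multiple, `2!·2!`, of the standard normalisation). -/
noncomputable def wedge22 {U : Type*} [AddCommGroup U] [Module ℝ U]
    (ζ β : U →ₗ[ℝ] U →ₗ[ℝ] ℝ) : (Fin 4 → U) → ℝ :=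
  fun v => ∑ σ : Equiv.Perm (Fin 4),
    ((Equiv.Perm.sign σ : ℤ) : ℝ) * (ζ (v (σ 0)) (v (σ 1)) * β (v (σ 2)) (v (σ 3)))

theorem sum_perm_fin_succ {M : Type*} [AddCommMonoid M] {n : ℕ}
    (f : Equiv.Perm (Fin (n + 1)) → M) :
    ∑ σ, f σ = ∑ i, ∑ τ, f (Equiv.Perm.decomposeFin.symm (i, τ)) := by
  rw [← Fintype.sum_prod_type', ← Equiv.sum_comp Equiv.Perm.decomposeFin.symm f]

theorem wedge22_apply {U : Type*} [AddCommGroup U] [Module ℝ U]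
    {ζ β : U →ₗ[ℝ] U →ₗ[ℝ] ℝ} (hζ : ζ.IsAlt) (hβ : β.IsAlt) (a b c d : U) :
    wedge22 ζ β ![a, b, c, d] =
      4 * (ζ a b * β c d - ζ a c * β b d + ζ a d * β b c
        + ζ b c * β a d - ζ b d * β a c + ζ c d * β a b) := by
  have hn : ∀ {γ : U →ₗ[ℝ] U →ₗ[ℝ] ℝ}, γ.IsAlt → ∀ x y, γ y x = -γ x y :=
    fun h x y => (h.neg x y).symm
  have h1 : (1 : Fin 4) = Fin.succ 0 := rfl
  have h2 : (2 : Fin 4) = Fin.succ (Fin.succ 0) := rfl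
  have h3 : (3 : Fin 4) = Fin.succ (Fin.succ (Fin.succ 0)) := rfl
  simp only [wedge22, sum_perm_fin_succ, Fin.sum_univ_succ, Finset.univ_unique,
    Finset.sum_singleton, Equiv.Perm.decomposeFin.symm_sign, h1, h2, h3,
    Equiv.Perm.decomposeFin_symm_apply_zero, Equiv.Perm.decomposeFin_symm_apply_succ]
  simp [Equiv.swap_apply_def, Fin.ext_iff]
  rw [hn hζ a b, hn hζ a c, hn hζ a d, hn hζ b c, hn hζ b d, hn hζ c d,
    hn hβ a b, hn hβ a c, hn hβ a d, hn hβ b c, hn hβ b d, hn hβ c d]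
  ring

/-- The common `ζ`-orthogonal complement of two vectors is not isotropic in dimension at
least `5`. -/
theorem exists_orthogonal_pair {U : Type*} [AddCommGroup U] [Module ℝ U]
    [FiniteDimensional ℝ U] (hdim : 5 ≤ finrank ℝ U) {ζ : U →ₗ[ℝ] U →ₗ[ℝ] ℝ}
    (hζ : LinearMap.ker ζ = ⊥) (a b : U) :
    ∃ c d, ζ a c = 0 ∧ ζ b c = 0 ∧ ζ a d = 0 ∧ ζ b d = 0 ∧ ζ c d = 1 := by
  set W := LinearMap.ker ((ζ a).prod (ζ b)) with hW
  have hmem : ∀ {x}, x ∈ W ↔ ζ a x = 0 ∧ ζ b x = 0 := by simp [hW]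
  suffices h : ∃ c ∈ W, ∃ d ∈ W, ζ c d ≠ 0 by
    obtain ⟨c, hc, d, hd, hcd⟩ := h
    rw [hmem] at hc hd
    exact ⟨c, (ζ c d)⁻¹ • d, hc.1, hc.2, by simp [hd.1], by simp [hd.2], by simp [hcd]⟩
  by_contra! h
  have hle : W.map ζ ≤ W.dualAnnihilator := by
    rintro _ ⟨c, hc, rfl⟩
    exact (Submodule.mem_dualAnnihilator _).2 (h c hc)
  have hrank := Submodule.finrank_mono hle
  rw [(Submodule.equivMapOfInjective ζ (LinearMap.ker_eq_bot.1 hζ) W).symm.finrank_eq] at hrank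
  have hann := Subspace.finrank_add_finrank_dualAnnihilator_eq W
  have hker := LinearMap.finrank_range_add_finrank_ker ((ζ a).prod (ζ b))
  have hrange := Submodule.finrank_le (LinearMap.range ((ζ a).prod (ζ b)))
  rw [finrank_prod, finrank_self] at hrange
  rw [← hW] at hker
  lia

/-- On a finite-dimensional real vector space of dimension at least 6 with a
nondegenerate 2-form `ζ`, wedging with `ζ` is injective on 2-forms: if
`ζ ∧ β = 0` then `β = 0`. -/
theorem stmt3 {U : Type*} [AddCommGroup U] [Module ℝ U] [FiniteDimensional ℝ U]
    (hdim : 6 ≤ finrank ℝ U)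
    (ζ : U →ₗ[ℝ] U →ₗ[ℝ] ℝ) (hζalt : ∀ v, ζ v v = 0)
    (hζnd : LinearMap.ker ζ = ⊥)
    (β : U →ₗ[ℝ] U →ₗ[ℝ] ℝ) (hβalt : ∀ v, β v v = 0)
    (hwedge : ∀ v : Fin 4 → U, wedge22 ζ β v = 0) :
    β = 0 := by
  have hpair : ∀ a b, ∃ c d, ζ a c = 0 ∧ ζ b c = 0 ∧ ζ a d = 0 ∧ ζ b d = 0 ∧ ζ c d = 1 ∧
      ζ a b * β c d + β a b = 0 := by
    intro a b
    obtain ⟨c, d, hac, hbc, had, hbd, hcd⟩ := exists_orthogonal_pair (by lia) hζnd a b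
    have h := hwedge ![a, b, c, d]
    rw [wedge22_apply hζalt hβalt, hac, hbc, had, hbd, hcd] at h
    exact ⟨c, d, hac, hbc, had, hbd, hcd, by linarith⟩
  have horth : ∀ a b, ζ a b = 0 → β a b = 0 := by
    intro a b hab
    obtain ⟨c, d, -, -, -, -, -, h⟩ := hpair a b
    simpa [hab] using h
  ext a b
  obtain ⟨c, d, hac, hbc, had, hbd, hcd, h⟩ := hpair a b
  have hcb : ζ c b = 0 := by rw [← LinearMap.IsAlt.neg hζalt, hbc, neg_zero]
  have hmix := horth (a + ζ a b • c) (b - d) (by simp [had, hcb, hcd])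
  simp only [map_add, map_sub, map_smul, LinearMap.add_apply, LinearMap.smul_apply,
    smul_eq_mul, horth a d had, horth c b hcb] at hmix
  rw [LinearMap.zero_apply, LinearMap.zero_apply]
  linarith
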